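/- Assume K is algebraically closed. Then every degenerate orbit of the ℤ^n-action on the set of maximal ideals of R contains a maximal break: if an orbit 𝒪 contains, for some i, a maximal ideal containing t_i, then there exists 𝔪 ∈ 𝒪 such that t_i ∈ 𝔪 for every index i for which 𝒪 contains some maximal ideal containing t_i. -/

import Mathlib

namespace MTW

abbrev Exp (n : ℕ) : Type := (Fin n → ℤ) × (Fin n → ℤ)

abbrev LR (K : Type) [Field K] (n : ℕ) : Type := AddMonoidAlgebra K (Exp n)

noncomputable def mon (K : Type) [Field K] (n : ℕ) (d : Exp n) : LR K n :=
  AddMonoidAlgebra.single d 1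

noncomputable def U (K : Type) [Field K] (n : ℕ) (j : Fin n) : LR K n :=
  mon K n (Pi.single j 1, 0)

noncomputable def V (K : Type) [Field K] (n : ℕ) (j : Fin n) : LR K n :=
  mon K n (0, Pi.single j 1)

noncomputable def tElt (K : Type) [Field K] (n : ℕ) (k : ℤ) (r s : Fin n → Fin n → K)
    (i : Fin n) : LR K n :=
  (r i i ^ k - s i i ^ k)⁻¹ •
    (r i i ^ k • mon K n (Pi.single i k, 0) - s i i ^ k • mon K n (0, Pi.single i k))

noncomputable def sigmaZ (K : Type) [Field K] (n : ℕ)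
    (σ : Fin n → (LR K n ≃ₐ[K] LR K n)) (g : Fin n → ℤ) : LR K n ≃ₐ[K] LR K n :=
  (List.ofFn fun i => σ i ^ (g i)).prod

def IsInvariantIdeal (K : Type) [Field K] (n : ℕ)
    (σ : Fin n → (LR K n ≃ₐ[K] LR K n)) (J : Ideal (LR K n)) : Prop :=
  ∀ (g : Fin n → ℤ), ∀ x ∈ J, sigmaZ K n σ g x ∈ J

noncomputable def invariants (K : Type) [Field K] (n : ℕ)
    (σ : Fin n → (LR K n ≃ₐ[K] LR K n)) : Subalgebra K (LR K n) :=
  ⨅ i, AlgHom.equalizer (σ i).toAlgHom (AlgHom.id K (LR K n))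

theorem mon_add (K : Type) [Field K] (n : ℕ) (d e : Exp n) :
    mon K n (d + e) = mon K n d * mon K n e := by
  simp [mon, AddMonoidAlgebra.single_mul_single]

theorem mon_zero (K : Type) [Field K] (n : ℕ) : mon K n 0 = 1 := rfl

/-- A monomial eigenvector of an algebra automorphism has eigenvector integer powers. -/
theorem map_mon_zsmul {K : Type} [Field K] {n : ℕ} (f : LR K n ≃ₐ[K] LR K n)
    {d : Exp n} {c : K} (hc : c ≠ 0) (h : f (mon K n d) = c • mon K n d) (z : ℤ) :
    f (mon K n (z • d)) = c ^ z • mon K n (z • d) := by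
  have hneg : f (mon K n (-d)) = c⁻¹ • mon K n (-d) := by
    have h₁ : mon K n d * mon K n (-d) = 1 := by rw [← mon_add, add_neg_cancel, mon_zero]
    have h₂ : mon K n d * f (mon K n (-d)) = c⁻¹ • 1 := by
      rw [eq_inv_smul_iff₀ hc, ← smul_mul_assoc, ← h, ← map_mul, h₁, map_one]
    calc f (mon K n (-d))
        = mon K n (-d) * (mon K n d * f (mon K n (-d))) := by
          rw [← mul_assoc, mul_comm (mon K n (-d)), h₁, one_mul]
      _ = c⁻¹ • mon K n (-d) := by rw [h₂, mul_smul_comm, mul_one]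
  induction z with
  | zero => simp [mon_zero]
  | succ m ih =>
    rw [add_smul, one_smul, mon_add, map_mul, ih, h, smul_mul_smul_comm, zpow_add_one₀ hc]
  | pred m ih =>
    rw [sub_smul, one_smul, sub_eq_add_neg, mon_add, map_mul, ih, hneg, smul_mul_smul_comm,
      zpow_sub_one₀ hc]

theorem zpow_apply_eq_smul {K A : Type*} [Field K] [Ring A] [Algebra K A] (f : A ≃ₐ[K] A)
    {x : A} {c : K} (hc : c ≠ 0) (h : f x = c • x) (z : ℤ) : (f ^ z) x = c ^ z • x := by
  have hinv : f⁻¹ x = c⁻¹ • x := by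
    rw [eq_inv_smul_iff₀ hc, ← map_smul, ← h]
    exact f.symm_apply_apply x
  induction z with
  | zero => simp
  | succ m ih => rw [zpow_add_one, AlgEquiv.mul_apply, h, map_smul, ih, smul_smul,
      zpow_add_one₀ hc, mul_comm]
  | pred m ih => rw [zpow_sub_one, AlgEquiv.mul_apply, hinv, map_smul, ih, smul_smul,
      zpow_sub_one₀ hc, mul_comm]

theorem prod_ofFn_apply_eq_smul {K A : Type*} [Field K] [Ring A] [Algebra K A] {m : ℕ}
    (f : Fin m → (A ≃ₐ[K] A)) {x : A} (c : Fin m → K) (h : ∀ j, f j x = c j • x) :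
    (List.ofFn f).prod x = (∏ j, c j) • x := by
  induction m with
  | zero => simp
  | succ m ih =>
    rw [List.ofFn_succ, List.prod_cons, AlgEquiv.mul_apply,
      ih (fun j => f j.succ) (fun j => c j.succ) (fun j => h j.succ), map_smul, h, smul_smul,
      Fin.prod_univ_succ, mul_comm]

theorem sigmaZ_mon_zsmul {K : Type} [Field K] {n : ℕ} (σ : Fin n → (LR K n ≃ₐ[K] LR K n))
    {d : Exp n} {c : Fin n → K} (hc : ∀ j, c j ≠ 0)
    (h : ∀ j, σ j (mon K n d) = (c j)⁻¹ • mon K n d) (k : ℤ) (g : Fin n → ℤ) :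
    sigmaZ K n σ g (mon K n (k • d)) = (∏ j, ((c j ^ k)⁻¹) ^ g j) • mon K n (k • d) := by
  refine prod_ofFn_apply_eq_smul _ _ fun j => ?_
  have hj := map_mon_zsmul (σ j) (inv_ne_zero (hc j)) (h j) k
  rw [inv_zpow] at hj
  exact zpow_apply_eq_smul (σ j) (inv_ne_zero (zpow_ne_zero k (hc j))) hj (g j)

/-- Whether `t_i` lies in `σ_g(J)` depends only on the `i`-th coordinate of `g`. -/
theorem tElt_mem_map_sigmaZ_of_eq {K : Type} [Field K] {n : ℕ} {k : ℤ}
    {r s : Fin n → Fin n → K} (hr : ∀ i j, r i j ≠ 0) (hs : ∀ i j, s i j ≠ 0)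
    (hrs : ∀ i j, i ≠ j → r i j ^ k = s i j ^ k)
    {σ : Fin n → (LR K n ≃ₐ[K] LR K n)}
    (hσu : ∀ i j, σ i (U K n j) = (r i j)⁻¹ • U K n j)
    (hσv : ∀ i j, σ i (V K n j) = (s i j)⁻¹ • V K n j)
    {J : Ideal (LR K n)} {i : Fin n} {g g' : Fin n → ℤ} (hg : g i = g' i)
    (h : tElt K n k r s i ∈ Ideal.map (sigmaZ K n σ g) J) :
    tElt K n k r s i ∈ Ideal.map (sigmaZ K n σ g') J := by
  have hP := sigmaZ_mon_zsmul σ (fun j => hr j i) (fun j => hσu j i) k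
  have hQ := sigmaZ_mon_zsmul σ (fun j => hs j i) (fun j => hσv j i) k
  have ePu : k • ((Pi.single i 1, 0) : Exp n) = (Pi.single i k, 0) := by
    ext j <;> simp [Pi.single_apply]
  have eQv : k • ((0, Pi.single i 1) : Exp n) = (0, Pi.single i k) := by
    ext j <;> simp [Pi.single_apply]
  rw [ePu] at hP
  rw [eQv] at hQ
  set a : (Fin n → ℤ) → K := fun g => ∏ j, ((r j i ^ k)⁻¹) ^ g j with ha
  set b : (Fin n → ℤ) → K := fun g => ∏ j, ((s j i ^ k)⁻¹) ^ g j with hb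
  have ha0 : ∀ g, a g ≠ 0 := fun g => Finset.prod_ne_zero_iff.2 fun j _ =>
    zpow_ne_zero _ (inv_ne_zero (zpow_ne_zero _ (hr j i)))
  have hb0 : ∀ g, b g ≠ 0 := fun g => Finset.prod_ne_zero_iff.2 fun j _ =>
    zpow_ne_zero _ (inv_ne_zero (zpow_ne_zero _ (hs j i)))
  have hab : a g' * (a g)⁻¹ = b g' * (b g)⁻¹ := by
    rw [← div_eq_mul_inv, ← div_eq_mul_inv, ha, hb, ← Finset.prod_div_distrib,
      ← Finset.prod_div_distrib]
    refine Finset.prod_congr rfl fun j _ => ?_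
    rcases eq_or_ne j i with rfl | hj
    · rw [hg, div_self, div_self]
      · exact zpow_ne_zero _ (inv_ne_zero (zpow_ne_zero _ (hs _ _)))
      · exact zpow_ne_zero _ (inv_ne_zero (zpow_ne_zero _ (hr _ _)))
    · rw [hrs j i hj]
  obtain ⟨y, hyJ, hy⟩ := (Ideal.mem_map_of_equiv (sigmaZ K n σ g) _).1 h
  have hsP : (sigmaZ K n σ g).symm (mon K n (Pi.single i k, 0)) =
      (a g)⁻¹ • mon K n (Pi.single i k, 0) := by
    rw [AlgEquiv.symm_apply_eq, map_smul, hP, inv_smul_smul₀ (ha0 g)]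
  have hsQ : (sigmaZ K n σ g).symm (mon K n (0, Pi.single i k)) =
      (b g)⁻¹ • mon K n (0, Pi.single i k) := by
    rw [AlgEquiv.symm_apply_eq, map_smul, hQ, inv_smul_smul₀ (hb0 g)]
  have key : sigmaZ K n σ g' y = (a g' * (a g)⁻¹) • tElt K n k r s i := by
    rw [← (sigmaZ K n σ g).symm_apply_apply y, hy]
    have hP' : sigmaZ K n σ g' ((sigmaZ K n σ g).symm (mon K n (Pi.single i k, 0))) =
        (a g' * (a g)⁻¹) • mon K n (Pi.single i k, 0) := by
      rw [hsP, map_smul, hP, smul_smul, mul_comm]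
    have hQ' : sigmaZ K n σ g' ((sigmaZ K n σ g).symm (mon K n (0, Pi.single i k))) =
        (a g' * (a g)⁻¹) • mon K n (0, Pi.single i k) := by
      rw [hsQ, map_smul, hQ, smul_smul, mul_comm, hab]
    simp only [tElt, map_smul, map_sub, hP', hQ']
    module
  have hmem := Ideal.mem_map_of_mem (sigmaZ K n σ g') hyJ
  rw [key] at hmem
  rw [← inv_smul_smul₀ (mul_ne_zero (ha0 g') (inv_ne_zero (ha0 g))) (tElt K n k r s i)]
  exact Submodule.smul_of_tower_mem _ _ hmem

/-- Over an algebraically closed field, every degenerate orbit of the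
`ℤ^n`-action on maximal ideals of `R` contains a maximal break: if the orbit of a
maximal ideal `𝔪₀` contains an `i`-break for some `i`, then some member
`σ_{g₀}(𝔪₀)` of the orbit contains `t_i` for every `i` for which the orbit contains
an `i`-break. -/
theorem statement10
    (K : Type) [Field K] [IsAlgClosed K] (n : ℕ) (hn : 0 < n)
    (k : ℤ) (hk : k ≠ 0) (r s : Fin n → Fin n → K)
    (hr : ∀ i j, r i j ≠ 0) (hs : ∀ i j, s i j ≠ 0)
    (hroot : ∀ i, ∀ m : ℕ, 0 < m → (r i i / s i i) ^ m ≠ 1)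
    (hrs : ∀ i j, i ≠ j → r i j ^ k = s i j ^ k)
    (σ : Fin n → (LR K n ≃ₐ[K] LR K n))
    (hσu : ∀ i j, σ i (U K n j) = (r i j)⁻¹ • U K n j)
    (hσv : ∀ i j, σ i (V K n j) = (s i j)⁻¹ • V K n j)
    (𝔪₀ : Ideal (LR K n)) (h𝔪₀ : 𝔪₀.IsMaximal)
    (hdeg : ∃ (i : Fin n) (g : Fin n → ℤ),
      tElt K n k r s i ∈ Ideal.map (sigmaZ K n σ g) 𝔪₀) :
    ∃ g₀ : Fin n → ℤ, ∀ i : Fin n,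
      (∃ g : Fin n → ℤ, tElt K n k r s i ∈ Ideal.map (sigmaZ K n σ g) 𝔪₀) →
      tElt K n k r s i ∈ Ideal.map (sigmaZ K n σ g₀) 𝔪₀ := by
  classical
  refine ⟨fun i => if h : ∃ g : Fin n → ℤ,
    tElt K n k r s i ∈ Ideal.map (sigmaZ K n σ g) 𝔪₀ then h.choose i else 0, fun i h => ?_⟩
  refine tElt_mem_map_sigmaZ_of_eq hr hs hrs hσu hσv ?_ h.choose_spec
  rw [dif_pos h]

end MTW
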